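/- Let K ⊂ ℝⁿ be a proper cone admitting a ν-LHSCB F, let x ∈ int K and s ∈ int K*, and suppose ‖δP‖_x < 1. Then ‖μ·F''(x)·δP − δD‖_x* ≤ μ·‖δP‖_x² / (1 − ‖δP‖_x)³. -/

import Mathlib

open Matrix

/-- The norm induced by a (positive definite) matrix `P`: `‖v‖_P = √(vᵀ P v)`. -/
noncomputable def vnorm {n : ℕ} (P : Matrix (Fin n) (Fin n) ℝ) (v : Fin n → ℝ) : ℝ :=
  Real.sqrt (v ⬝ᵥ (P *ᵥ v))

/-- The operator norm `‖Q‖_P = sup {‖Q u‖_{P⁻¹} : ‖u‖_P ≤ 1}`. -/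
noncomputable def opNorm {n : ℕ} (P Q : Matrix (Fin n) (Fin n) ℝ) : ℝ :=
  sSup ((fun u => vnorm P⁻¹ (Q *ᵥ u)) '' {u : Fin n → ℝ | vnorm P u ≤ 1})

/-- The Loewner order: `Loewner P Q` means `P ⪯ Q`, i.e. `Q - P` is positive semidefinite. -/
def Loewner {n : ℕ} (P Q : Matrix (Fin n) (Fin n) ℝ) : Prop :=
  (Q - P).PosSemidef

/-- A ν-logarithmically homogeneous self-concordant barrier `F` for a proper cone `K ⊆ ℝⁿ`,
with gradient `grad` and Hessian `hess`. -/
structure LHSCB (n : ℕ) (ν : ℝ) where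
  K : Set (Fin n → ℝ)
  F : (Fin n → ℝ) → ℝ
  grad : (Fin n → ℝ) → (Fin n → ℝ)
  hess : (Fin n → ℝ) → Matrix (Fin n) (Fin n) ℝ
  nu_ge_one : 1 ≤ ν
  cone_convex : Convex ℝ K
  cone_closed : IsClosed K
  cone_pointed : ∀ x, x ∈ K → -x ∈ K → x = 0
  cone_fullDim : (interior K).Nonempty
  cone_smul : ∀ t : ℝ, 0 < t → ∀ x ∈ K, t • x ∈ K
  smooth : ContDiffOn ℝ 3 F (interior K)
  strictConvex : StrictConvexOn ℝ (interior K) F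
  grad_eq : ∀ x ∈ interior K, ∀ v, fderiv ℝ F x v = grad x ⬝ᵥ v
  hess_eq : ∀ x ∈ interior K, ∀ u, fderiv ℝ grad x u = hess x *ᵥ u
  hess_symm : ∀ x ∈ interior K, (hess x).IsSymm
  hess_posdef : ∀ x ∈ interior K, (hess x).PosDef
  logHom : ∀ t : ℝ, 0 < t → ∀ x ∈ interior K, F (t • x) = F x - ν * Real.log t
  dikin : ∀ x ∈ interior K, ∀ y, vnorm (hess x) (y - x) < 1 → y ∈ interior K
  selfConc : ∀ x ∈ interior K, ∀ x' ∈ interior K, vnorm (hess x) (x' - x) < 1 →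
    Loewner ((1 - vnorm (hess x) (x' - x)) ^ 2 • hess x') (hess x) ∧
    Loewner (hess x) (((1 - vnorm (hess x) (x' - x)) ^ 2)⁻¹ • hess x')

/-- A ν-LHSCB `B` for a proper cone `K` together with its conjugate barrier `Bstar`
(a ν-LHSCB for the dual cone `K*`, equal on `int K*` to the convex conjugate of `B.F`). -/
structure LHSCBPair (n : ℕ) (ν : ℝ) where
  B : LHSCB n ν
  Bstar : LHSCB n ν
  dual_eq : Bstar.K = {s | ∀ x ∈ B.K, 0 ≤ x ⬝ᵥ s}
  conj_eq : ∀ s ∈ interior Bstar.K,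
    Bstar.F s = sSup ((fun x => -(s ⬝ᵥ x) - B.F x) '' interior B.K)

lemma sq_vnorm {n : ℕ} {P : Matrix (Fin n) (Fin n) ℝ} (hP : P.PosDef) (v : Fin n → ℝ) :
    vnorm P v ^ 2 = v ⬝ᵥ (P *ᵥ v) :=
  Real.sq_sqrt (by simpa using hP.posSemidef.dotProduct_mulVec_nonneg v)

lemma vnorm_smul_of_nonneg {n : ℕ} (P : Matrix (Fin n) (Fin n) ℝ) (v : Fin n → ℝ) {t : ℝ}
    (ht : 0 ≤ t) : vnorm P (t • v) = t * vnorm P v := by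
  have h : (t • v) ⬝ᵥ (P *ᵥ (t • v)) = t ^ 2 * (v ⬝ᵥ (P *ᵥ v)) := by
    simp only [mulVec_smul, smul_dotProduct, dotProduct_smul, smul_eq_mul]
    ring
  rw [vnorm, vnorm, h, Real.sqrt_mul (sq_nonneg t), Real.sqrt_sq ht]

lemma vnorm_neg {n : ℕ} (P : Matrix (Fin n) (Fin n) ℝ) (v : Fin n → ℝ) :
    vnorm P (-v) = vnorm P v := by
  simp [vnorm, mulVec_neg]

lemma continuous_vnorm {n : ℕ} (P : Matrix (Fin n) (Fin n) ℝ) : Continuous (vnorm P) := by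
  unfold vnorm dotProduct mulVec dotProduct
  fun_prop

lemma Loewner.dotProduct_mulVec_le {n : ℕ} {P Q : Matrix (Fin n) (Fin n) ℝ} (h : Loewner P Q)
    (u : Fin n → ℝ) : u ⬝ᵥ (P *ᵥ u) ≤ u ⬝ᵥ (Q *ᵥ u) := by
  have := h.dotProduct_mulVec_nonneg u
  simpa [sub_mulVec, dotProduct_sub] using this

/-- Polarization: a symmetric bilinear form is controlled by a bound on its quadratic form. -/
lemma two_mul_dotProduct_mulVec_le {n : ℕ} {M H : Matrix (Fin n) (Fin n) ℝ} (hM : M.IsSymm)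
    {δ : ℝ} (h : ∀ u, |u ⬝ᵥ (M *ᵥ u)| ≤ δ * (u ⬝ᵥ (H *ᵥ u))) (v w : Fin n → ℝ) :
    2 * (v ⬝ᵥ (M *ᵥ w)) ≤ δ * (v ⬝ᵥ (H *ᵥ v) + w ⬝ᵥ (H *ᵥ w)) := by
  have h1 := (abs_le.1 (h (v + w))).2
  have h2 := (abs_le.1 (h (v - w))).1
  have hs : w ⬝ᵥ (M *ᵥ v) = v ⬝ᵥ (M *ᵥ w) := by
    rw [dotProduct_mulVec, ← mulVec_transpose, hM.eq, dotProduct_comm]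
  simp only [mulVec_add, mulVec_sub, dotProduct_add, dotProduct_sub, add_dotProduct,
    sub_dotProduct, hs] at h1 h2
  linarith

lemma isCompact_setOf_vnorm_sub_le {n : ℕ} {P : Matrix (Fin n) (Fin n) ℝ} (hP : P.PosDef)
    (x : Fin n → ℝ) (r : ℝ) : IsCompact {y | vnorm P (y - x) ≤ r} := by
  have hsymm : P.IsSymm := by simpa [IsHermitian, IsSymm] using hP.isHermitian
  have hdet : IsUnit P.det := (P.isUnit_iff_isUnit_det).1 hP.isUnit
  have hinv : (P⁻¹).IsSymm := by simpa [IsHermitian, IsSymm] using hP.inv.isHermitian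
  have habs : ∀ u, |u ⬝ᵥ (P *ᵥ u)| ≤ 1 * (u ⬝ᵥ (P *ᵥ u)) := fun u => by
    rw [one_mul, ← sq_vnorm hP, abs_of_nonneg (sq_nonneg _)]
  have key : ∀ v z : Fin n → ℝ,
      2 * (v ⬝ᵥ z) ≤ (P⁻¹ *ᵥ v) ⬝ᵥ (P *ᵥ (P⁻¹ *ᵥ v)) + vnorm P z ^ 2 := by
    intro v z
    have := two_mul_dotProduct_mulVec_le hsymm habs (P⁻¹ *ᵥ v) z
    have e : (P⁻¹ *ᵥ v) ⬝ᵥ (P *ᵥ z) = v ⬝ᵥ z := by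
      rw [← hinv.eq, mulVec_transpose, ← dotProduct_mulVec, mulVec_mulVec, nonsing_inv_mul _ hdet,
        one_mulVec]
    rw [e, ← sq_vnorm hP z] at this
    linarith
  refine IsCompact.of_isClosed_subset (isCompact_Icc
    (a := fun i => x i - ((P⁻¹ *ᵥ (-Pi.single i 1)) ⬝ᵥ (P *ᵥ (P⁻¹ *ᵥ (-Pi.single i 1))) + r ^ 2))
    (b := fun i => x i + ((P⁻¹ *ᵥ Pi.single i 1) ⬝ᵥ (P *ᵥ (P⁻¹ *ᵥ Pi.single i 1)) + r ^ 2)))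
    (isClosed_le ((continuous_vnorm P).comp (by fun_prop)) continuous_const) ?_
  intro y hy
  have hn : 0 ≤ vnorm P (y - x) := Real.sqrt_nonneg _
  have hsq : vnorm P (y - x) ^ 2 ≤ r ^ 2 := pow_le_pow_left₀ hn hy 2
  have hpos : ∀ v : Fin n → ℝ, 0 ≤ (P⁻¹ *ᵥ v) ⬝ᵥ (P *ᵥ (P⁻¹ *ᵥ v)) := fun v => by
    rw [← sq_vnorm hP]; positivity
  constructor
  · intro i
    have h1 := key (-Pi.single i 1) (y - x)
    have h2 := hpos (-Pi.single i 1)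
    simp only [neg_dotProduct, single_dotProduct, Pi.sub_apply, one_mul] at h1
    show _ - (_ + _) ≤ y i
    linarith [sq_nonneg r]
  · intro i
    have h1 := key (Pi.single i 1) (y - x)
    have h2 := hpos (Pi.single i 1)
    simp only [single_dotProduct, Pi.sub_apply, one_mul] at h1
    show y i ≤ _ + (_ + _)
    linarith [sq_nonneg r]

namespace LHSCB

variable {n : ℕ} {ν : ℝ} (B : LHSCB n ν)

lemma contDiffAt {x : Fin n → ℝ} (hx : x ∈ interior B.K) : ContDiffAt ℝ 3 B.F x :=
  B.smooth.contDiffAt (isOpen_interior.mem_nhds hx)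

lemma convex_interior : Convex ℝ (interior B.K) := B.cone_convex.interior

lemma hasDerivAt_line {x h : Fin n → ℝ} {t : ℝ} (hx : x + t • h ∈ interior B.K) :
    HasDerivAt (fun τ : ℝ => B.F (x + τ • h)) (B.grad (x + t • h) ⬝ᵥ h) t := by
  have hF : HasFDerivAt B.F (fderiv ℝ B.F (x + t • h)) (x + t • h) :=
    ((B.contDiffAt hx).differentiableAt (by norm_num)).hasFDerivAt
  have hl : HasDerivAt (fun τ : ℝ => x + τ • h) h t := by
    simpa using ((hasDerivAt_id t).smul_const h).const_add x
  have := hF.comp_hasDerivAt t hl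
  rwa [B.grad_eq _ hx] at this

lemma differentiableAt_grad {x : Fin n → ℝ} (hx : x ∈ interior B.K) :
    DifferentiableAt ℝ B.grad x := by
  refine differentiableAt_pi.2 fun i => ?_
  have h1 : DifferentiableAt ℝ (fun y => fderiv ℝ B.F y (Pi.single i 1)) x :=
    (((B.contDiffAt hx).fderiv_right (m := 2) (by norm_num)).differentiableAt
      (by norm_num)).clm_apply (differentiableAt_const _)
  refine h1.congr_of_eventuallyEq ?_
  filter_upwards [isOpen_interior.mem_nhds hx] with y hy
  simp [B.grad_eq y hy]

lemma hasDerivAt_grad_line {x h : Fin n → ℝ} {t : ℝ} (hx : x + t • h ∈ interior B.K)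
    (v : Fin n → ℝ) :
    HasDerivAt (fun τ : ℝ => v ⬝ᵥ B.grad (x + τ • h)) (v ⬝ᵥ (B.hess (x + t • h) *ᵥ h)) t := by
  have hl : HasDerivAt (fun τ : ℝ => x + τ • h) h t := by
    simpa using ((hasDerivAt_id t).smul_const h).const_add x
  have := (B.differentiableAt_grad hx).hasFDerivAt.comp_hasDerivAt t hl
  rw [B.hess_eq _ hx] at this
  exact HasDerivAt.fun_sum fun i _ => ((hasDerivAt_pi.1 this) i).const_mul (v i)

lemma add_smul_sub_mem {x y : Fin n → ℝ} (hx : x ∈ interior B.K) (hy : y ∈ interior B.K)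
    {t : ℝ} (h0 : 0 ≤ t) (h1 : t ≤ 1) : x + t • (y - x) ∈ interior B.K :=
  B.convex_interior.add_smul_sub_mem hx hy ⟨h0, h1⟩

/-- The gradient inequality for the convex function `F`. -/
lemma add_grad_dotProduct_le {x y : Fin n → ℝ} (hx : x ∈ interior B.K) (hy : y ∈ interior B.K) :
    B.F x + B.grad x ⬝ᵥ (y - x) ≤ B.F y := by
  have hconv : ConvexOn ℝ (Set.Icc (0 : ℝ) 1) (fun τ : ℝ => B.F (x + τ • (y - x))) := by
    refine ⟨convex_Icc 0 1, fun a ha b hb p q hp hq hpq => ?_⟩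
    have := B.strictConvex.convexOn.2 (B.add_smul_sub_mem hx hy ha.1 ha.2)
      (B.add_smul_sub_mem hx hy hb.1 hb.2) hp hq hpq
    convert this using 2
    obtain rfl : p = 1 - q := by linarith
    simp only [smul_eq_mul]
    module
  have hd := B.hasDerivAt_line (x := x) (h := y - x) (t := 0) (by simpa using hx)
  have := hconv.le_slope_of_hasDerivAt (by simp) (by simp) one_pos hd
  simp only [slope_def_field, zero_smul, one_smul, add_zero, add_sub_cancel, sub_zero,
    div_one] at this
  linarith

open scoped Pointwise in
lemma smul_mem {x : Fin n → ℝ} (hx : x ∈ interior B.K) {t : ℝ} (ht : 0 < t) :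
    t • x ∈ interior B.K := by
  have h1 : t • B.K ⊆ B.K := by
    rintro _ ⟨y, hy, rfl⟩
    exact B.cone_smul t ht y hy
  have h2 : t • x ∈ t • interior B.K := Set.smul_mem_smul_set hx
  rw [← interior_smul₀ ht.ne'] at h2
  exact interior_mono h1 h2

lemma ne_zero {x : Fin n → ℝ} (hx : x ∈ interior B.K) : x ≠ 0 := by
  rintro rfl
  have h := B.logHom 2 two_pos 0 hx
  have h2 : 0 < ν * Real.log 2 := mul_pos (one_pos.trans_le B.nu_ge_one) (Real.log_pos one_lt_two)
  rw [smul_zero] at h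
  linarith

lemma grad_smul {x : Fin n → ℝ} (hx : x ∈ interior B.K) {t : ℝ} (ht : 0 < t) :
    t • B.grad (t • x) = B.grad x := by
  refine dotProduct_eq _ _ fun v => ?_
  have hF : HasFDerivAt B.F (fderiv ℝ B.F (t • x)) (t • x) :=
    ((B.contDiffAt (B.smul_mem hx ht)).differentiableAt (by norm_num)).hasFDerivAt
  have h1 := hF.comp x ((hasFDerivAt_id x).const_smul t)
  have h2 : HasFDerivAt (fun y => B.F y - ν * Real.log t) (fderiv ℝ B.F x) x :=
    ((B.contDiffAt hx).differentiableAt (by norm_num)).hasFDerivAt.sub_const _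
  have h3 := h2.congr_of_eventuallyEq (f₁ := fun y => B.F (t • y)) (by
    filter_upwards [isOpen_interior.mem_nhds hx] with y hy using B.logHom t ht y hy)
  have := congrArg (fun L => L v) (h1.unique h3)
  simpa [B.grad_eq _ hx, B.grad_eq _ (B.smul_mem hx ht)] using this

lemma selfConc_quadratic {x y : Fin n → ℝ} (hx : x ∈ interior B.K) (hy : y ∈ interior B.K)
    (h : vnorm (B.hess x) (y - x) < 1) (u : Fin n → ℝ) :
    (1 - vnorm (B.hess x) (y - x)) ^ 2 * (u ⬝ᵥ (B.hess y *ᵥ u)) ≤ u ⬝ᵥ (B.hess x *ᵥ u) ∧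
    (1 - vnorm (B.hess x) (y - x)) ^ 2 * (u ⬝ᵥ (B.hess x *ᵥ u)) ≤ u ⬝ᵥ (B.hess y *ᵥ u) := by
  obtain ⟨h1, h2⟩ := B.selfConc x hx y hy h
  have h1 := h1.dotProduct_mulVec_le u
  have h2 := h2.dotProduct_mulVec_le u
  simp only [smul_mulVec, dotProduct_smul, smul_eq_mul] at h1 h2
  refine ⟨h1, ?_⟩
  have hpos : 0 < (1 - vnorm (B.hess x) (y - x)) ^ 2 := pow_pos (sub_pos.2 h) 2
  rwa [← le_inv_mul_iff₀ hpos]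

/-- At a boundary point of the Dikin ball of radius `1/2` the function `s · + F` is either larger
than at the centre, or the midpoint decreases it by a fixed amount. -/
lemma midpoint_gap {x y s : Fin n → ℝ} (hx : x ∈ interior B.K)
    (hr : vnorm (B.hess x) (y - x) = 1 / 2) (hle : s ⬝ᵥ y + B.F y ≤ s ⬝ᵥ x + B.F x) :
    s ⬝ᵥ (x + (1 / 2 : ℝ) • (y - x)) + B.F (x + (1 / 2 : ℝ) • (y - x)) ≤
      s ⬝ᵥ x + B.F x - 1 / 128 := by
  have hy : y ∈ interior B.K := B.dikin x hx y (by rw [hr]; norm_num)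
  set h := y - x with hh
  have hmem : ∀ t ∈ Set.Icc (0 : ℝ) 1, x + t • h ∈ interior B.K := fun t ht =>
    B.add_smul_sub_mem hx hy ht.1 ht.2
  have hd : ∀ t ∈ Set.Icc (0 : ℝ) 1, HasDerivAt
      (fun τ : ℝ => B.F (x + τ • h) - 1 / 32 * τ ^ 2)
      (h ⬝ᵥ B.grad (x + t • h) - 1 / 16 * t) t := by
    intro t ht
    refine ((B.hasDerivAt_line (hmem t ht)).fun_sub
      ((hasDerivAt_pow 2 t).const_mul (1 / 32))).congr_deriv ?_
    rw [dotProduct_comm h]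
    norm_num
    ring
  have hd2 : ∀ t ∈ Set.Icc (0 : ℝ) 1, HasDerivAt
      (fun t : ℝ => h ⬝ᵥ B.grad (x + t • h) - 1 / 16 * t)
      (h ⬝ᵥ (B.hess (x + t • h) *ᵥ h) - 1 / 16) t := by
    intro t ht
    exact ((B.hasDerivAt_grad_line (hmem t ht) h).fun_sub
      ((hasDerivAt_id t).const_mul (1 / 16))).congr_deriv (by simp)
  have hconv : ConvexOn ℝ (Set.Icc (0 : ℝ) 1)
      (fun τ : ℝ => B.F (x + τ • h) - 1 / 32 * τ ^ 2) := by
    refine convexOn_of_hasDerivWithinAt2_nonneg (convex_Icc 0 1)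
      (fun t ht => (hd t ht).continuousAt.continuousWithinAt)
      (fun t ht => (hd t (interior_subset ht)).hasDerivWithinAt)
      (fun t ht => (hd2 t (interior_subset ht)).hasDerivWithinAt) fun t ht => ?_
    have ht' := interior_subset ht
    have hv : vnorm (B.hess x) (x + t • h - x) = t * (1 / 2) := by
      rw [add_sub_cancel_left, vnorm_smul_of_nonneg _ _ ht'.1, hr]
    have h1 := (B.selfConc_quadratic hx (hmem t ht') (by rw [hv]; linarith [ht'.2]) h).2
    rw [hv, ← sq_vnorm (B.hess_posdef x hx) h, hr] at h1
    have h2 : 1 / 4 ≤ (1 - t * (1 / 2)) ^ 2 := by nlinarith [ht'.1, ht'.2]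
    linarith
  have := hconv.2 (Set.left_mem_Icc.2 zero_le_one) (Set.right_mem_Icc.2 zero_le_one)
    (show (0 : ℝ) ≤ 1 / 2 by norm_num) (show (0 : ℝ) ≤ 1 / 2 by norm_num) (by norm_num)
  have e : x + h = y := by rw [hh]; abel
  norm_num [e] at this
  have e2 : s ⬝ᵥ (x + (1 / 2 : ℝ) • h) = (s ⬝ᵥ x + s ⬝ᵥ y) / 2 := by
    rw [hh, dotProduct_add, dotProduct_smul, dotProduct_sub, smul_eq_mul]
    ring
  rw [e2]
  norm_num
  linarith

/-- Every `s` for which `s · + F` is bounded below on the interior of the cone is the negative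
gradient of `F` at some interior point. -/
lemma exists_grad_eq_neg (s : Fin n → ℝ)
    (hb : BddBelow ((fun x => s ⬝ᵥ x + B.F x) '' interior B.K)) :
    ∃ y ∈ interior B.K, B.grad y = -s := by
  set φ : (Fin n → ℝ) → ℝ := fun x => s ⬝ᵥ x + B.F x with hφ
  obtain ⟨_, ⟨x, hx, rfl⟩, hlt⟩ := exists_lt_of_csInf_lt (B.cone_fullDim.image φ)
    (lt_add_of_pos_right (sInf (φ '' interior B.K)) (by norm_num : (0 : ℝ) < 1 / 128))
  have hgap : ∀ y, vnorm (B.hess x) (y - x) = 1 / 2 → φ x < φ y := by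
    intro y hr
    by_contra! hle
    have hy : y ∈ interior B.K := B.dikin x hx y (by rw [hr]; norm_num)
    have h1 := B.midpoint_gap hx hr hle
    have h2 := csInf_le hb (Set.mem_image_of_mem φ
      (B.add_smul_sub_mem hx hy (t := 1 / 2) (by norm_num) (by norm_num)))
    simp only [hφ] at hlt h2
    linarith
  have hsub : ∀ y ∈ {y | vnorm (B.hess x) (y - x) ≤ 1 / 2}, y ∈ interior B.K := fun y hy =>
    B.dikin x hx y (lt_of_le_of_lt hy (by norm_num))
  have hcont : ContinuousOn φ {y | vnorm (B.hess x) (y - x) ≤ 1 / 2} := by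
    have h1 : Continuous fun y : Fin n → ℝ => s ⬝ᵥ y := by unfold dotProduct; fun_prop
    exact h1.continuousOn.add (B.smooth.continuousOn.mono hsub)
  have hxm : x ∈ {y | vnorm (B.hess x) (y - x) ≤ 1 / 2} := by simp [vnorm]
  obtain ⟨y, hy, hmin⟩ := (isCompact_setOf_vnorm_sub_le (B.hess_posdef x hx) x
    (1 / 2)).exists_isMinOn ⟨x, hxm⟩ hcont
  have hylt : vnorm (B.hess x) (y - x) < 1 / 2 :=
    lt_of_le_of_ne hy fun h => absurd (hmin hxm) (not_le.2 (hgap y h))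
  have hyK := hsub y hy
  refine ⟨y, hyK, dotProduct_eq _ _ fun v => ?_⟩
  have hopen : IsOpen {y | vnorm (B.hess x) (y - x) < 1 / 2} :=
    isOpen_lt ((continuous_vnorm _).comp (by fun_prop)) continuous_const
  have hloc : IsLocalMin φ y := by
    filter_upwards [hopen.mem_nhds hylt] with z hz using hmin (le_of_lt hz)
  have hloc' : IsLocalMin (fun τ : ℝ => φ (y + τ • v)) 0 := by
    have hc : Filter.Tendsto (fun τ : ℝ => y + τ • v) (nhds 0) (nhds y) := by
      have : Continuous fun τ : ℝ => y + τ • v := by fun_prop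
      simpa using this.tendsto 0
    filter_upwards [hc.eventually hloc] with τ hτ
    simpa using hτ
  have hder : HasDerivAt (fun τ : ℝ => φ (y + τ • v)) (s ⬝ᵥ v + B.grad y ⬝ᵥ v) 0 := by
    have h1 : HasDerivAt (fun τ : ℝ => s ⬝ᵥ (y + τ • v)) (s ⬝ᵥ v) 0 := by
      simp only [dotProduct_add, dotProduct_smul, smul_eq_mul]
      simpa using ((hasDerivAt_id (0 : ℝ)).mul_const (s ⬝ᵥ v)).const_add (s ⬝ᵥ y)
    have h2 := B.hasDerivAt_line (x := y) (h := v) (t := 0) (by simpa using hyK)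
    rw [zero_smul, add_zero] at h2
    exact h1.fun_add h2
  have := hloc'.hasDerivAt_eq_zero hder
  rw [neg_dotProduct]
  linarith

/-- First-order Taylor remainder of the gradient of a self-concordant function. -/
lemma vnorm_inv_grad_remainder_le {x y : Fin n → ℝ} (hx : x ∈ interior B.K)
    (hr : vnorm (B.hess x) (y - x) < 1) :
    vnorm (B.hess x)⁻¹ (B.grad y - B.grad x - B.hess x *ᵥ (y - x)) ≤
      vnorm (B.hess x) (y - x) ^ 2 / (1 - vnorm (B.hess x) (y - x)) := by
  have hy := B.dikin x hx y hr
  set h := y - x with hh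
  set H := B.hess x with hH
  set r := vnorm H h with hr'
  have hP : H.PosDef := B.hess_posdef x hx
  have hr0 : 0 ≤ r := Real.sqrt_nonneg _
  set g := B.grad y - B.grad x - H *ᵥ h with hg
  have hmem : ∀ t ∈ Set.Icc (0 : ℝ) 1, x + t • h ∈ interior B.K := fun t ht =>
    B.add_smul_sub_mem hx hy ht.1 ht.2
  have hbil : ∀ t ∈ Set.Icc (0 : ℝ) 1, ∀ v : Fin n → ℝ,
      2 * (v ⬝ᵥ ((B.hess (x + t • h) - H) *ᵥ h)) ≤
        (((1 - t * r) ^ 2)⁻¹ - 1) * (v ⬝ᵥ (H *ᵥ v) + r ^ 2) := by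
    intro t ht v
    have hv : vnorm (B.hess x) (x + t • h - x) = t * r := by
      rw [add_sub_cancel_left, vnorm_smul_of_nonneg _ _ ht.1]
    have htr : t * r < 1 := lt_of_le_of_lt (mul_le_of_le_one_left hr0 ht.2) hr
    have htr0 : 0 ≤ t * r := mul_nonneg ht.1 hr0
    rw [hr', sq_vnorm hP]
    refine two_mul_dotProduct_mulVec_le ((B.hess_symm _ (hmem t ht)).sub (B.hess_symm x hx))
      (fun u => ?_) v h
    obtain ⟨h1, h2⟩ := B.selfConc_quadratic hx (hmem t ht) (by rwa [hv]) u
    rw [hv] at h1 h2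
    have hq : 0 ≤ u ⬝ᵥ (H *ᵥ u) := by rw [← sq_vnorm hP]; positivity
    rw [← hr', sub_mulVec, dotProduct_sub]
    have hp : 0 < (1 - t * r) ^ 2 := pow_pos (by linarith) 2
    rw [← le_inv_mul_iff₀ hp] at h1
    have hc : 1 - (1 - t * r) ^ 2 ≤ ((1 - t * r) ^ 2)⁻¹ - 1 := by
      have h3 : ((1 - t * r) ^ 2) * ((1 - t * r) ^ 2)⁻¹ = 1 := mul_inv_cancel₀ hp.ne'
      nlinarith [sq_nonneg ((1 - t * r) ^ 2 - 1), inv_pos.2 hp]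
    have hm := mul_le_mul_of_nonneg_right hc hq
    rw [abs_le]
    constructor <;> linarith
  have hbound : ∀ v : Fin n → ℝ, 2 * (v ⬝ᵥ g) * (1 - r) ≤ r * (v ⬝ᵥ (H *ᵥ v) + r ^ 2) := by
    intro v
    have hr1 : ∀ t ∈ Set.Icc (0 : ℝ) 1, 0 < 1 - t * r := fun t ht => by
      linarith [mul_le_of_le_one_left hr0 ht.2]
    have hf : ∀ t ∈ Set.Icc (0 : ℝ) 1, HasDerivAt
        (fun t : ℝ => 2 * (v ⬝ᵥ B.grad (x + t • h) - t * (v ⬝ᵥ (H *ᵥ h))))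
        (2 * (v ⬝ᵥ ((B.hess (x + t • h) - H) *ᵥ h))) t := fun t ht =>
      (((B.hasDerivAt_grad_line (hmem t ht) v).fun_sub
        ((hasDerivAt_id t).mul_const (v ⬝ᵥ (H *ᵥ h)))).const_mul 2).congr_deriv
        (by rw [sub_mulVec, dotProduct_sub, one_mul])
    have hB : ∀ t ∈ Set.Icc (0 : ℝ) 1, HasDerivAt
        (fun t : ℝ => 2 * (v ⬝ᵥ B.grad x) + (t / (1 - t * r) - t) * (v ⬝ᵥ (H *ᵥ v) + r ^ 2))
        ((((1 - t * r) ^ 2)⁻¹ - 1) * (v ⬝ᵥ (H *ᵥ v) + r ^ 2)) t := fun t ht =>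
      (((((hasDerivAt_id t).fun_div (((hasDerivAt_id t).mul_const r).const_sub 1)
        (hr1 t ht).ne').fun_sub (hasDerivAt_id t)).mul_const _).const_add _).congr_deriv (by
          have := (hr1 t ht).ne'
          congr 2
          rw [inv_eq_one_div]
          congr 1
          simp only [id]
          ring)
    have hle := image_le_of_deriv_right_le_deriv_boundary
      (fun t ht => (hf t ht).continuousAt.continuousWithinAt)
      (fun t ht => (hf t (Set.Ico_subset_Icc_self ht)).hasDerivWithinAt) (by simp)
      (fun t ht => (hB t ht).continuousAt.continuousWithinAt)
      (fun t ht => (hB t (Set.Ico_subset_Icc_self ht)).hasDerivWithinAt)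
      (fun t ht => hbil t (Set.Ico_subset_Icc_self ht) v) (Set.right_mem_Icc.2 zero_le_one)
    have e : x + h = y := by rw [hh]; abel
    simp only [one_smul, e, one_mul] at hle
    have h1r : 0 < 1 - r := sub_pos.2 hr
    have h2 : 2 * (v ⬝ᵥ g) ≤ (1 / (1 - r) - 1) * (v ⬝ᵥ (H *ᵥ v) + r ^ 2) := by
      rw [hg, dotProduct_sub, dotProduct_sub]
      linarith
    calc 2 * (v ⬝ᵥ g) * (1 - r)
        ≤ (1 / (1 - r) - 1) * (v ⬝ᵥ (H *ᵥ v) + r ^ 2) * (1 - r) :=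
          mul_le_mul_of_nonneg_right h2 h1r.le
      _ = r * (v ⬝ᵥ (H *ᵥ v) + r ^ 2) := by
          field_simp
          ring
  set N := vnorm H⁻¹ g with hN
  have hN0 : 0 ≤ N := Real.sqrt_nonneg _
  have hdet : IsUnit H.det := (H.isUnit_iff_isUnit_det).1 hP.isUnit
  have hNsq : (H⁻¹ *ᵥ g) ⬝ᵥ g = N ^ 2 := by rw [dotProduct_comm, hN, sq_vnorm hP.inv]
  have hscaled : ∀ c : ℝ, 2 * (c * N ^ 2) * (1 - r) ≤ r * (c ^ 2 * N ^ 2 + r ^ 2) := by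
    intro c
    have := hbound (c • (H⁻¹ *ᵥ g))
    rw [mulVec_smul, mulVec_mulVec, mul_nonsing_inv _ hdet, one_mulVec] at this
    simp only [smul_dotProduct, dotProduct_smul, smul_eq_mul, hNsq] at this
    linarith
  rw [le_div_iff₀ (sub_pos.2 hr)]
  rcases hr0.eq_or_lt with h0 | h0
  · have := hscaled 1
    rw [← h0] at this ⊢
    nlinarith
  rcases hN0.eq_or_lt with h1 | h1
  · rw [← h1, zero_mul]
    positivity
  have h2 := hscaled (r / N)
  have e1 : r / N * N ^ 2 = r * N := by field_simp
  have e2 : (r / N) ^ 2 * N ^ 2 = r ^ 2 := by field_simp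
  rw [e1, e2] at h2
  have h3 : 2 * r * (N * (1 - r)) ≤ 2 * r * r ^ 2 := by linarith
  exact le_of_mul_le_mul_left h3 (by positivity)

end LHSCB

/-- The gradient of the conjugate barrier inverts, up to sign, the negative gradient map. -/
lemma LHSCBPair.neg_grad_star_spec {n : ℕ} {ν : ℝ} (Bp : LHSCBPair n ν) {s : Fin n → ℝ}
    (hs : s ∈ interior Bp.Bstar.K) :
    -Bp.Bstar.grad s ∈ interior Bp.B.K ∧ Bp.B.grad (-Bp.Bstar.grad s) = -s := by
  have hbdd : ∀ s ∈ interior Bp.Bstar.K,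
      BddBelow ((fun x => s ⬝ᵥ x + Bp.B.F x) '' interior Bp.B.K) := by
    intro s hs
    obtain ⟨e, he⟩ := Bp.B.cone_fullDim
    have hc : Filter.Tendsto (fun η : ℝ => s + η • Bp.B.grad e) (nhdsWithin 0 (Set.Ioi 0))
        (nhds s) := by
      have : Continuous fun η : ℝ => s + η • Bp.B.grad e := by fun_prop
      simpa using (this.tendsto 0).mono_left nhdsWithin_le_nhds
    obtain ⟨η, hη, hη0⟩ := ((hc.eventually (isOpen_interior.mem_nhds hs)).and
      self_mem_nhdsWithin).exists
    have hη0 : 0 < η := hη0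
    have hy := Bp.B.smul_mem he (inv_pos.2 hη0)
    have hgrad : Bp.B.grad (η⁻¹ • e) = η • Bp.B.grad e := by
      rw [← Bp.B.grad_smul he (inv_pos.2 hη0), smul_smul, mul_inv_cancel₀ hη0.ne', one_smul]
    have hK := interior_subset hη
    rw [Bp.dual_eq, ← hgrad] at hK
    refine ⟨Bp.B.F (η⁻¹ • e) - Bp.B.grad (η⁻¹ • e) ⬝ᵥ (η⁻¹ • e), ?_⟩
    rintro _ ⟨x, hx, rfl⟩
    have h1 := Bp.B.add_grad_dotProduct_le hy hx
    have h2 := hK x (interior_subset hx)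
    rw [dotProduct_comm, add_dotProduct] at h2
    rw [dotProduct_sub] at h1
    show _ ≤ s ⬝ᵥ x + Bp.B.F x
    linarith
  obtain ⟨y, hy, hgy⟩ := Bp.B.exists_grad_eq_neg s (hbdd s hs)
  suffices h : -Bp.Bstar.grad s = y by rw [h]; exact ⟨hy, hgy⟩
  have hFs : Bp.Bstar.F s = -(s ⬝ᵥ y) - Bp.B.F y := by
    rw [Bp.conj_eq s hs]
    refine IsGreatest.csSup_eq ⟨⟨y, hy, rfl⟩, ?_⟩
    rintro _ ⟨x, hx, rfl⟩
    have h1 := Bp.B.add_grad_dotProduct_le hy hx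
    rw [hgy, neg_dotProduct, dotProduct_sub] at h1
    show -(s ⬝ᵥ x) - Bp.B.F x ≤ _
    linarith
  have hge : ∀ s' ∈ interior Bp.Bstar.K, -(s' ⬝ᵥ y) - Bp.B.F y ≤ Bp.Bstar.F s' := by
    intro s' hs'
    rw [Bp.conj_eq s' hs']
    refine le_csSup ?_ ⟨y, hy, rfl⟩
    obtain ⟨m, hm⟩ := hbdd s' hs'
    refine ⟨-m, ?_⟩
    rintro _ ⟨x, hx, rfl⟩
    have : m ≤ s' ⬝ᵥ x + Bp.B.F x := hm ⟨x, hx, rfl⟩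
    show -(s' ⬝ᵥ x) - Bp.B.F x ≤ _
    linarith
  refine dotProduct_eq _ _ fun v => ?_
  have hloc : IsLocalMin (fun τ : ℝ => Bp.Bstar.F (s + τ • v) + (s + τ • v) ⬝ᵥ y) 0 := by
    have hc : Filter.Tendsto (fun τ : ℝ => s + τ • v) (nhds 0) (nhds s) := by
      have : Continuous fun τ : ℝ => s + τ • v := by fun_prop
      simpa using this.tendsto 0
    filter_upwards [hc.eventually (isOpen_interior.mem_nhds hs)] with τ hτ
    have := hge _ hτ
    simp only [zero_smul, add_zero]
    linarith
  have hder : HasDerivAt (fun τ : ℝ => Bp.Bstar.F (s + τ • v) + (s + τ • v) ⬝ᵥ y)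
      (Bp.Bstar.grad s ⬝ᵥ v + v ⬝ᵥ y) 0 := by
    have h1 : HasDerivAt (fun τ : ℝ => (s + τ • v) ⬝ᵥ y) (v ⬝ᵥ y) 0 := by
      simp only [add_dotProduct, smul_dotProduct, smul_eq_mul]
      simpa using ((hasDerivAt_id (0 : ℝ)).mul_const (v ⬝ᵥ y)).const_add (s ⬝ᵥ y)
    have h2 := Bp.Bstar.hasDerivAt_line (x := s) (h := v) (t := 0) (by simpa using hs)
    rw [zero_smul, add_zero] at h2
    exact h2.fun_add h1
  have := hloc.hasDerivAt_eq_zero hder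
  rw [neg_dotProduct, dotProduct_comm y]
  linarith

lemma LHSCBPair.dotProduct_pos {n : ℕ} {ν : ℝ} (Bp : LHSCBPair n ν) {x s : Fin n → ℝ}
    (hx : x ∈ interior Bp.B.K) (hs : s ∈ interior Bp.Bstar.K) : 0 < x ⬝ᵥ s := by
  have hc : Filter.Tendsto (fun η : ℝ => s - η • x) (nhdsWithin 0 (Set.Ioi 0)) (nhds s) := by
    have : Continuous fun η : ℝ => s - η • x := by fun_prop
    simpa using (this.tendsto 0).mono_left nhdsWithin_le_nhds
  obtain ⟨η, hη, hη0⟩ := ((hc.eventually (isOpen_interior.mem_nhds hs)).and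
    self_mem_nhdsWithin).exists
  have hη0 : 0 < η := hη0
  have h1 := interior_subset hη
  rw [Bp.dual_eq] at h1
  have h2 := h1 x (interior_subset hx)
  rw [dotProduct_sub, dotProduct_smul, smul_eq_mul] at h2
  have h3 : 0 < x ⬝ᵥ x := by
    have := dotProduct_star_self_pos_iff (v := x) |>.2 (Bp.B.ne_zero hx)
    simpa using this
  have := mul_pos hη0 h3
  linarith

/-- If `‖δP‖_x < 1` then `‖μ F''(x) δP − δD‖_x* ≤ μ ‖δP‖_x² / (1 − ‖δP‖_x)³`. -/
theorem stmt3 {n : ℕ} {ν : ℝ} (Bp : LHSCBPair n ν)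
    (x s : Fin n → ℝ) (hx : x ∈ interior Bp.B.K) (hs : s ∈ interior Bp.Bstar.K)
    (st xt : Fin n → ℝ) (hst : st = -Bp.B.grad x) (hxt : xt = -Bp.Bstar.grad s)
    (μ : ℝ) (hμ : μ = x ⬝ᵥ s / ν)
    (δP δD : Fin n → ℝ) (hδP : δP = x - μ • xt) (hδD : δD = s - μ • st)
    (hsmall : vnorm (Bp.B.hess x) δP < 1) :
    vnorm (Bp.B.hess x)⁻¹ (μ • (Bp.B.hess x *ᵥ δP) - δD) ≤
      μ * vnorm (Bp.B.hess x) δP ^ 2 / (1 - vnorm (Bp.B.hess x) δP) ^ 3 := by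
  have hν : 0 < ν := one_pos.trans_le Bp.B.nu_ge_one
  have hμ0 : 0 < μ := hμ ▸ div_pos (Bp.dotProduct_pos hx hs) hν
  obtain ⟨hxK, hgrad⟩ := Bp.neg_grad_star_spec hs
  rw [← hxt] at hxK hgrad
  set H := Bp.B.hess x with hH
  have hw : μ • xt - x = -δP := by rw [hδP]; abel
  have hvn : vnorm H (μ • xt - x) = vnorm H δP := by rw [hw, vnorm_neg]
  have key := Bp.B.vnorm_inv_grad_remainder_le hx (y := μ • xt) (by rwa [← hH, hvn])
  rw [← hH, hvn] at key
  have hg : μ • Bp.B.grad (μ • xt) = -s := by rw [Bp.B.grad_smul hxK hμ0, hgrad]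
  have e : μ • (H *ᵥ δP) - δD = μ • (Bp.B.grad (μ • xt) - Bp.B.grad x - H *ᵥ (μ • xt - x)) := by
    rw [smul_sub, smul_sub, hg, hw, mulVec_neg, hδD, hst]
    module
  rw [e, vnorm_smul_of_nonneg _ _ hμ0.le, mul_div_assoc]
  refine mul_le_mul_of_nonneg_left (key.trans ?_) hμ0.le
  have h0 : 0 ≤ vnorm H δP := Real.sqrt_nonneg _
  have h1 : 0 < 1 - vnorm H δP := sub_pos.2 hsmall
  refine div_le_div_of_nonneg_left (sq_nonneg _) (pow_pos h1 3) ?_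
  exact pow_le_of_le_one h1.le (by linarith) (by norm_num)
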